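/- Let G be a connected k-regular finite simple graph with n vertices and m edges, where k > 2 and the girth g(G) > 4, and let U be its Grover transition matrix and A = A(G) its adjacency matrix. Then the characteristic polynomial of (U³)⁺ satisfies, for every complex number λ, det(λ·I_{2m} − (U³)⁺) = (λ² − 4)^{m−n} · det( λ²·I_n − λ·(A³ − (3k−4)·A) + (A⁴ − k²·A² + 2(k−1)(k²−2k+2)·I_n) ). -/

import Mathlib

open Matrix SimpleGraph

variable {V : Type*} [Fintype V] [DecidableEq V]

/-- The Grover transition matrix `U` of a graph `G`, indexed by darts (arcs):
`U e f = 2/deg(t(f)) - 1` if `f = e⁻¹`, `U e f = 2/deg(t(f))` if `t(f) = o(e)` and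
`f ≠ e⁻¹`, and `0` otherwise.  (When `t(f) = o(e)` we have `deg (t f) = deg (o e)`.) -/
noncomputable def grover (G : SimpleGraph V) [DecidableRel G.Adj] :
    Matrix G.Dart G.Dart ℝ := fun e f =>
  if f = e.symm then 2 / (G.degree e.toProd.1) - 1
  else if f.toProd.2 = e.toProd.1 then 2 / (G.degree e.toProd.1) else 0

/-- The positive support of a real square matrix. -/
noncomputable def posSupp {α : Type*} (M : Matrix α α ℝ) : Matrix α α ℝ :=
  fun i j => if 0 < M i j then 1 else 0

/-- The matrix `B` with `B e f = 1` iff `t(e) = o(f)`. -/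
def Bmat (G : SimpleGraph V) [DecidableRel G.Adj] : Matrix G.Dart G.Dart ℝ :=
  fun e f => if e.toProd.2 = f.toProd.1 then 1 else 0

/-- The arc-inversion matrix `J₀` with `(J₀) e f = 1` iff `f = e⁻¹`. -/
def J0 (G : SimpleGraph V) [DecidableRel G.Adj] : Matrix G.Dart G.Dart ℝ :=
  fun e f => if f = e.symm then 1 else 0

/-- The diagonal degree matrix of `G`. -/
noncomputable def degMat (G : SimpleGraph V) [DecidableRel G.Adj] : Matrix V V ℝ :=
  Matrix.diagonal fun v => (G.degree v : ℝ)


section Aux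

lemma ind_mul_ind {R : Type*} [CommRing R] (P Q : Prop) [Decidable P] [Decidable Q] :
    ((if P then 1 else 0) * (if Q then 1 else 0) : R) = if P ∧ Q then 1 else 0 := by
  by_cases P <;> by_cases Q <;> simp [*]

set_option linter.unusedSectionVars false
set_option linter.unusedSimpArgs false
variable (G : SimpleGraph V) [DecidableRel G.Adj] (R : Type*) [CommRing R]

/-- origin incidence matrix -/
def Smat : Matrix V G.Dart R := fun v d => if d.fst = v then 1 else 0

/-- terminus incidence matrix -/
def Tmat : Matrix V G.Dart R := fun v d => if d.snd = v then 1 else 0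

/-- arc inversion -/
def Jmat : Matrix G.Dart G.Dart R := fun e f => if f = e.symm then 1 else 0

/-- edge incidence matrix -/
def Kmat : Matrix G.edgeSet G.Dart R := fun v d => if d.edge = v.1 then 1 else 0

lemma S_J : Smat G R * Jmat G R = Tmat G R := by
  ext v d
  simp only [Matrix.mul_apply, Smat, Jmat, Tmat]
  rw [Finset.sum_eq_single d.symm]
  · simp
  · intro b _ hb
    have : d ≠ b.symm := fun h => hb (by rw [h, Dart.symm_symm])
    simp [this]
  · simp

lemma J_J : Jmat G R * Jmat G R = 1 := by
  ext v d
  simp only [Matrix.mul_apply, Jmat, Matrix.one_apply]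
  rw [Finset.sum_eq_single v.symm]
  · simp [eq_comm]
  · intro b _ hb
    simp [hb]
  · simp

lemma J_tr : (Jmat G R)ᵀ = Jmat G R := by
  ext v d
  simp only [Jmat, Matrix.transpose_apply]
  have : v = d.symm ↔ d = v.symm := by
    constructor <;> (rintro rfl; simp)
  simp [this]

lemma T_J : Tmat G R * Jmat G R = Smat G R := by
  rw [← S_J, Matrix.mul_assoc, J_J, Matrix.mul_one]

lemma J_St : Jmat G R * (Smat G R)ᵀ = (Tmat G R)ᵀ := by
  rw [← S_J, Matrix.transpose_mul, J_tr]

lemma J_Tt : Jmat G R * (Tmat G R)ᵀ = (Smat G R)ᵀ := by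
  rw [← T_J, Matrix.transpose_mul, J_tr]

lemma S_Tt : Smat G R * (Tmat G R)ᵀ = G.adjMatrix R := by
  ext u v
  simp only [Matrix.mul_apply, Smat, Tmat, Matrix.transpose_apply, adjMatrix_apply]
  by_cases h : G.Adj u v
  · rw [Finset.sum_eq_single (⟨(u, v), h⟩ : G.Dart)]
    · simp [h]
    · intro b _ hb
      have : ¬ (b.fst = u ∧ b.snd = v) := by
        rintro ⟨rfl, rfl⟩; exact hb rfl
      rw [ind_mul_ind]
      simp [this]
    · simp
  · rw [if_neg h]
    refine Finset.sum_eq_zero fun b _ => ?_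
    have : ¬ (b.fst = u ∧ b.snd = v) := by
      rintro ⟨rfl, rfl⟩; exact h b.adj
    rw [ind_mul_ind]
    simp [this]

lemma T_St : Tmat G R * (Smat G R)ᵀ = G.adjMatrix R := by
  rw [← transpose_adjMatrix, ← S_Tt, Matrix.transpose_mul, Matrix.transpose_transpose]

variable {G} in
lemma S_St {k : ℕ} (hreg : G.IsRegularOfDegree k) :
    Smat G R * (Smat G R)ᵀ = (k : R) • (1 : Matrix V V R) := by
  ext u v
  simp only [Matrix.mul_apply, Smat, Matrix.transpose_apply, Matrix.smul_apply, Matrix.one_apply,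
    ind_mul_ind]
  by_cases h : u = v
  · subst h
    have := G.dart_fst_fiber_card_eq_degree u
    rw [hreg u] at this
    simp only [and_self, Finset.sum_boole, if_true, smul_eq_mul, mul_one, this]
  · rw [Finset.sum_eq_zero]
    · simp [h]
    · intro b _
      rw [if_neg]
      rintro ⟨rfl, rfl⟩; exact h rfl

variable {G} in
lemma T_Tt {k : ℕ} (hreg : G.IsRegularOfDegree k) :
    Tmat G R * (Tmat G R)ᵀ = (k : R) • (1 : Matrix V V R) := by
  rw [← S_St R hreg, ← J_St, ← Matrix.mul_assoc, T_J]

lemma Kt_K : (Kmat G R)ᵀ * Kmat G R = 1 + Jmat G R := by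
  ext d f
  simp only [Matrix.mul_apply, Kmat, Jmat, Matrix.transpose_apply, Matrix.add_apply,
    Matrix.one_apply]
  rw [Finset.sum_eq_single (⟨d.edge, d.edge_mem⟩ : G.edgeSet)]
  · have h := dart_edge_eq_iff f d
    have h2 : d ≠ d.symm := d.symm_ne.symm
    by_cases h1 : f = d
    · subst h1; simp [h2]
    · by_cases h3 : f = d.symm
      · subst h3; simp [h2]
      · simp [h, h1, h3, Ne.symm h1]
  · intro b _ hb
    have : d.edge ≠ b.1 := fun h => hb (Subtype.ext h.symm)
    simp [this]
  · simp

lemma K_Kt : Kmat G R * (Kmat G R)ᵀ = (2 : R) • 1 := by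
  ext u v
  simp only [Matrix.mul_apply, Kmat, Matrix.transpose_apply, Matrix.smul_apply, Matrix.one_apply,
    ind_mul_ind]
  by_cases h : u = v
  · subst h
    have := G.dart_edge_fiber_card u.1 u.2
    simp only [and_self, Finset.sum_boole, if_true, smul_eq_mul, mul_one, this]; norm_num
  · rw [Finset.sum_eq_zero]
    · simp [h]
    · intro b _
      rw [if_neg]
      rintro ⟨h1, h2⟩; exact h (Subtype.ext (h1.symm.trans h2))

lemma det_J (lam : ℂ) (h : lam ≠ 2) :
    det (lam • (1 : Matrix G.Dart G.Dart ℂ) + (2 : ℂ) • Jmat G ℂ) =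
      (lam ^ 2 - 4) ^ G.edgeFinset.card := by
  have h' : lam - 2 ≠ 0 := sub_ne_zero.2 h
  have e : lam • (1 : Matrix G.Dart G.Dart ℂ) + (2 : ℂ) • Jmat G ℂ =
      (lam - 2) • (1 + ((2 / (lam - 2)) • (Kmat G ℂ)ᵀ) * Kmat G ℂ) := by
    rw [Matrix.smul_mul, Kt_K, smul_add, smul_smul, mul_div_cancel₀ _ h']
    module
  have e2 : (1 : Matrix G.edgeSet G.edgeSet ℂ) + (2 / (lam - 2)) • (2 : ℂ) • 1 =
      ((lam + 2) / (lam - 2)) • 1 := by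
    have : (lam + 2) / (lam - 2) = 1 + (2 / (lam - 2)) * 2 := by field_simp; ring
    rw [this]; module
  rw [e, det_smul, det_one_add_mul_comm, Matrix.mul_smul, K_Kt, e2, det_smul, det_one,
    G.dart_card_eq_twice_card_edges, ← edgeFinset_card, pow_mul, mul_one, ← mul_pow]
  congr 1
  field_simp
  ring

lemma entry_SXT (X : Matrix V V R) (e f : G.Dart) :
    ((Smat G R)ᵀ * (X * Tmat G R)) e f = X e.fst f.snd := by
  simp [Matrix.mul_apply, Smat, Tmat]

lemma entry_SXS (X : Matrix V V R) (e f : G.Dart) :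
    ((Smat G R)ᵀ * (X * Smat G R)) e f = X e.fst f.fst := by
  simp [Matrix.mul_apply, Smat]

lemma entry_TXT (X : Matrix V V R) (e f : G.Dart) :
    ((Tmat G R)ᵀ * (X * Tmat G R)) e f = X e.snd f.snd := by
  simp [Matrix.mul_apply, Tmat]

lemma entry_ST (e f : G.Dart) :
    ((Smat G R)ᵀ * Tmat G R) e f = if e.fst = f.snd then 1 else 0 := by
  have := entry_SXT G R 1 e f
  rwa [Matrix.one_mul, Matrix.one_apply] at this

lemma entry_TS (e f : G.Dart) :
    ((Tmat G R)ᵀ * Smat G R) e f = if e.snd = f.fst then 1 else 0 := by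
  simp [Matrix.mul_apply, Smat, Tmat, eq_comm]

variable {G}

lemma grover_eq {k : ℕ} (hreg : G.IsRegularOfDegree k) :
    grover G = (2 / k : ℝ) • ((Smat G ℝ)ᵀ * Tmat G ℝ) - Jmat G ℝ := by
  ext e f
  rw [Matrix.sub_apply, Matrix.smul_apply, entry_ST]
  simp only [grover, Jmat, hreg e.toProd.1]
  by_cases h : f = e.symm
  · subst h; simp
  · simp [h, eq_comm]

lemma grover_cube {k : ℕ} (hreg : G.IsRegularOfDegree k) (hk : 2 < k) :
    grover G ^ 3 = (2 / k : ℝ) ^ 3 • ((Smat G ℝ)ᵀ * ((G.adjMatrix ℝ ^ 2) * Tmat G ℝ))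
      - (2 / k : ℝ) ^ 2 • ((Smat G ℝ)ᵀ * (G.adjMatrix ℝ * Smat G ℝ))
      - (2 / k : ℝ) ^ 2 • ((Tmat G ℝ)ᵀ * (G.adjMatrix ℝ * Tmat G ℝ))
      + (2 / k : ℝ) • ((Tmat G ℝ)ᵀ * Smat G ℝ) - Jmat G ℝ := by
  have hk0 : (k : ℝ) ≠ 0 := by positivity
  rw [grover_eq hreg]
  obtain ⟨t, ht⟩ : ∃ t : ℝ, t = 2 / k := ⟨_, rfl⟩
  have htk : t * k = 2 := by rw [ht]; field_simp
  rw [← ht, pow_succ, pow_two]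
  have a1 : ∀ X : Matrix V G.Dart ℝ, Smat G ℝ * ((Smat G ℝ)ᵀ * X) = (k : ℝ) • X := fun X => by
    rw [← Matrix.mul_assoc, S_St ℝ hreg]; simp
  have a2 : ∀ X : Matrix V G.Dart ℝ, Tmat G ℝ * ((Smat G ℝ)ᵀ * X) = G.adjMatrix ℝ * X := fun X => by
    rw [← Matrix.mul_assoc, T_St]
  have a3 : ∀ X : Matrix V G.Dart ℝ, Jmat G ℝ * ((Smat G ℝ)ᵀ * X) = (Tmat G ℝ)ᵀ * X := fun X => by
    rw [← Matrix.mul_assoc, J_St]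
  simp only [Matrix.mul_sub, Matrix.sub_mul, Matrix.smul_mul, Matrix.mul_smul, Matrix.mul_assoc,
    a1, a2, a3, S_J, T_J, J_J, Matrix.one_mul, smul_sub, smul_smul, pow_two, Matrix.mul_one]
  have : t * t * k = 2 * t := by rw [mul_assoc, htk, mul_comm]
  have h2 : t * (t * k) = 2 * t := by rw [htk, mul_comm]
  simp only [this, h2]
  module

lemma four_cycle (hg : 4 < G.egirth) {b c p q : V} (hbc : b ≠ c) (h1 : G.Adj b p) (h2 : G.Adj p c)
    (h3 : G.Adj b q) (h4 : G.Adj q c) : p = q := by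
  by_contra hpq
  let w : G.Walk b b := .cons h1 (.cons h2 (.cons h4.symm (.cons h3.symm .nil)))
  have hw : w.IsCycle := by
    rw [Walk.isCycle_def, Walk.isTrail_def]
    have := h1.ne; have := h2.ne; have := h3.ne; have := h4.ne
    simp [w]
    grind
  have := egirth_le_length hw
  exact absurd (lt_of_lt_of_le hg this) (by simp [w])

lemma adj_sq_eq_one (hg : 4 < G.egirth) {b c p : V} (hbc : b ≠ c) (h1 : G.Adj b p)
    (h2 : G.Adj p c) : (G.adjMatrix ℝ ^ 2) b c = 1 := by
  rw [pow_two, Matrix.mul_apply, Finset.sum_eq_single p]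
  · simp [h1, h2]
  · intro q _ hq
    simp only [adjMatrix_apply, ind_mul_ind]
    rw [if_neg]
    rintro ⟨h3, h4⟩
    exact hq (four_cycle hg hbc h1 h2 h3 h4).symm
  · simp

lemma adj_sq_cases (hg : 4 < G.egirth) {b c : V} (hbc : b ≠ c) :
    (G.adjMatrix ℝ ^ 2) b c = 1 ∨ (G.adjMatrix ℝ ^ 2) b c = 0 := by
  by_cases h : ∃ p, G.Adj b p ∧ G.Adj p c
  · obtain ⟨p, h1, h2⟩ := h
    exact .inl (adj_sq_eq_one hg hbc h1 h2)
  · right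
    rw [pow_two, Matrix.mul_apply]
    refine Finset.sum_eq_zero fun q _ => ?_
    simp only [adjMatrix_apply, ind_mul_ind]
    exact if_neg fun h' => h ⟨q, h'⟩

lemma posSupp_cube {k : ℕ} (hreg : G.IsRegularOfDegree k) (hk : 2 < k) (hg : 4 < G.egirth) :
    posSupp (grover G ^ 3) =
      (Smat G ℝ)ᵀ * ((G.adjMatrix ℝ ^ 2 - ((k : ℝ) - 2) • (1 : Matrix V V ℝ)) * Tmat G ℝ)
      - (Smat G ℝ)ᵀ * (G.adjMatrix ℝ * Smat G ℝ)
      - (Tmat G ℝ)ᵀ * (G.adjMatrix ℝ * Tmat G ℝ)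
      + (2 : ℝ) • ((Tmat G ℝ)ᵀ * Smat G ℝ) - (2 : ℝ) • Jmat G ℝ := by
  ext e f
  have hk2 : (2 : ℝ) < k := by exact_mod_cast hk
  obtain ⟨t, ht⟩ : ∃ t : ℝ, t = 2 / k := ⟨_, rfl⟩
  have htk : t * k = 2 := by rw [ht]; field_simp
  have ht0 : 0 < t := by rw [ht]; positivity
  have ht1 : t < 1 := by rw [ht, div_lt_one (by linarith)]; exact hk2
  rw [posSupp, grover_cube hreg hk, ← ht]
  simp only [Matrix.sub_apply, Matrix.add_apply, Matrix.smul_apply, entry_SXT, entry_SXS, entry_TXT,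
    entry_TS, smul_eq_mul, Jmat, Matrix.one_apply, adjMatrix_apply]
  obtain ⟨⟨c, d⟩, hcd⟩ := e
  obtain ⟨⟨a, b⟩, hab⟩ := f
  have hsymm : ((⟨(a, b), hab⟩ : G.Dart) = (⟨(c, d), hcd⟩ : G.Dart).symm) ↔ (a = d ∧ b = c) := by
    simp [Dart.ext_iff, Dart.symm]
  simp only [hsymm]
  simp only at hcd hab ⊢
  by_cases hbc : b = c
  · subst hbc
    have hA : (G.adjMatrix ℝ ^ 2) b b = k := by
      rw [pow_two, adjMatrix_mul_self_apply_self, hreg b]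
    have e1 : t ^ 3 * (k : ℝ) = 2 * t ^ 2 := by rw [← htk]; ring
    rw [hA, e1]
    by_cases had : a = d
    · subst had
      simp only [hcd, hcd.symm, hab.symm, if_true, and_self]
      rw [if_neg (by linarith)]; ring
    · simp only [hcd.symm, hab.symm, had, Ne.symm had, if_true, if_false, false_and]
      rw [if_neg (by linarith)]; ring
  · have hcb : c ≠ b := Ne.symm hbc
    by_cases had : a = d
    · subst had
      rw [adj_sq_eq_one hg hcb hcd hab]
      simp [hbc, hcb, hcd, hab, hab.symm]
      have : 0 < t * (1 - t) ^ 2 := by have := sub_pos.2 ht1; positivity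
      rw [if_pos (by linarith)]; norm_num
    · have hlt : t ^ 3 < t ^ 2 := by nlinarith [pow_pos ht0 2]
      by_cases h1 : G.Adj c a
      · by_cases h2 : G.Adj d b
        · exact absurd (four_cycle hg hcb h1 hab hcd h2) had
        · rw [adj_sq_eq_one hg hcb h1 hab]
          simp [had, Ne.symm had, hbc, hcb, h1, h2]
          linarith
      · by_cases h2 : G.Adj d b
        · rw [adj_sq_eq_one hg hcb hcd h2]
          simp [had, Ne.symm had, hbc, hcb, h1, h2]
          linarith
        · rcases adj_sq_cases hg hcb with h | h <;> rw [h] <;>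
            simp [had, Ne.symm had, hbc, hcb, h1, h2, ht0]


lemma det_blocks_aux (A B C D : Matrix V V ℂ) (h : C * D = D * C) (hD : IsUnit D.det) :
    (fromBlocks A B C D).det = (A * D - B * C).det := by
  have := Matrix.invertibleOfIsUnitDet D hD
  rw [det_fromBlocks₂₂, mul_comm, ← det_mul, Matrix.sub_mul, Matrix.mul_assoc (B * ⅟D), h,
    Matrix.mul_assoc B, ← Matrix.mul_assoc (⅟D), invOf_mul_self, Matrix.one_mul]

lemma det_blocks (A B C D : Matrix V V ℂ) (h : C * D = D * C) :
    (fromBlocks A B C D).det = (A * D - B * C).det := by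
  have hd : Dense {x : ℂ | (x • (1 : Matrix V V ℂ) + D).det ≠ 0} := by
    have : {x : ℂ | (x • (1 : Matrix V V ℂ) + D).det ≠ 0} = {x | (-D).charpoly.IsRoot x}ᶜ := by
      ext x
      simp [Polynomial.IsRoot, Matrix.eval_charpoly, Matrix.smul_one_eq_diagonal,
        Matrix.scalar_apply]
    rw [this]
    apply Set.Countable.dense_compl ℂ
    exact (Polynomial.finite_setOfPred_isRoot (Matrix.charpoly_monic _).ne_zero).countable
  have := Continuous.ext_on hd (f := fun x : ℂ => (fromBlocks A B C (x • 1 + D)).det)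
    (g := fun x : ℂ => (A * (x • 1 + D) - B * C).det) (by fun_prop) (by fun_prop) (by
      intro x hx
      exact det_blocks_aux _ _ _ _ (by simp [Matrix.mul_add, Matrix.add_mul, h]) hx.isUnit)
  simpa using congrFun this 0

lemma det_transfer {D E : Type*} [Fintype D] [DecidableEq D] [Fintype E] [DecidableEq E]
    (L' : Matrix D D ℂ) (L : Matrix E E ℂ) (Wt : Matrix D E ℂ) (Y : Matrix E D ℂ)
    (h : L' * Wt = Wt * L) (h1 : IsUnit L'.det) (h2 : IsUnit L.det) :
    (L' - Wt * Y).det * L.det = L'.det * (L - Y * Wt).det := by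
  have i1 := Matrix.mul_nonsing_inv L' h1
  have i1' := Matrix.nonsing_inv_mul L' h1
  have i2 := Matrix.mul_nonsing_inv L h2
  have i2' := Matrix.nonsing_inv_mul L h2
  have e0 : L'⁻¹ * Wt = Wt * L⁻¹ := by
    calc L'⁻¹ * Wt = L'⁻¹ * (Wt * L) * L⁻¹ := by
          rw [Matrix.mul_assoc, Matrix.mul_assoc, i2, Matrix.mul_one]
      _ = Wt * L⁻¹ := by rw [← h, ← Matrix.mul_assoc, i1', Matrix.one_mul]
  have e1 : L' - Wt * Y = L' * (1 - (L'⁻¹ * Wt) * Y) := by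
    rw [Matrix.mul_sub, Matrix.mul_one, ← Matrix.mul_assoc, ← Matrix.mul_assoc, i1, Matrix.one_mul]
  rw [e1, det_mul, det_one_sub_mul_comm, mul_assoc, ← det_mul, Matrix.sub_mul, Matrix.one_mul, e0,
    ← Matrix.mul_assoc, Matrix.mul_assoc _ L⁻¹ L, i2', Matrix.mul_one]

lemma map_posSupp {k : ℕ} (hreg : G.IsRegularOfDegree k) (hk : 2 < k) (hg : 4 < G.egirth) :
    (posSupp (grover G ^ 3)).map (fun x : ℝ => (x : ℂ)) =
      (Smat G ℂ)ᵀ * ((G.adjMatrix ℂ ^ 2 - ((k : ℂ) - 2) • (1 : Matrix V V ℂ)) * Tmat G ℂ)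
      - (Smat G ℂ)ᵀ * (G.adjMatrix ℂ * Smat G ℂ)
      - (Tmat G ℂ)ᵀ * (G.adjMatrix ℂ * Tmat G ℂ)
      + (2 : ℂ) • ((Tmat G ℂ)ᵀ * Smat G ℂ) - (2 : ℂ) • Jmat G ℂ := by
  rw [posSupp_cube hreg hk hg]
  have hite : ∀ (P : Prop) [Decidable P], (((if P then 1 else 0 : ℝ)) : ℂ) = if P then 1 else 0 := by
    intro P _
    by_cases P <;> simp [*]
  have hA : ∀ u v, (((G.adjMatrix ℝ ^ 2) u v : ℝ) : ℂ) = (G.adjMatrix ℂ ^ 2) u v := by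
    intro u v
    simp only [pow_two, Matrix.mul_apply, adjMatrix_apply, ind_mul_ind]
    rw [Complex.ofReal_sum]
    exact Finset.sum_congr rfl fun i _ => hite _
  ext e f
  simp only [Matrix.map_apply, Matrix.sub_apply, Matrix.add_apply, Matrix.smul_apply, entry_SXT,
    entry_SXS, entry_TXT, entry_TS, smul_eq_mul, Jmat, Matrix.one_apply, adjMatrix_apply]
  push_cast
  simp only [hA, hite]

lemma W_eq (A : Matrix V V ℂ) (k : ℂ) :
      (Smat G ℂ)ᵀ * ((A ^ 2 - (k - 2) • (1 : Matrix V V ℂ)) * Tmat G ℂ)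
      - (Smat G ℂ)ᵀ * (A * Smat G ℂ)
      - (Tmat G ℂ)ᵀ * (A * Tmat G ℂ)
      + (2 : ℂ) • ((Tmat G ℂ)ᵀ * Smat G ℂ) =
    fromCols (Smat G ℂ)ᵀ (Tmat G ℂ)ᵀ *
      (fromBlocks (-A) (A ^ 2 - (k - 2) • (1 : Matrix V V ℂ)) ((2 : ℂ) • (1 : Matrix V V ℂ)) (-A) *
        fromRows (Smat G ℂ) (Tmat G ℂ)) := by
  rw [fromBlocks_mul_fromRows, fromCols_mul_fromRows]
  simp only [Matrix.mul_add, Matrix.neg_mul, Matrix.mul_neg, Matrix.smul_mul, Matrix.one_mul,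
    Matrix.mul_smul]
  abel

lemma L_comm (lam : ℂ) :
    (lam • (1 : Matrix G.Dart G.Dart ℂ) + (2 : ℂ) • Jmat G ℂ) *
        fromCols (Smat G ℂ)ᵀ (Tmat G ℂ)ᵀ =
      fromCols (Smat G ℂ)ᵀ (Tmat G ℂ)ᵀ *
        fromBlocks (lam • (1 : Matrix V V ℂ)) ((2 : ℂ) • (1 : Matrix V V ℂ))
        ((2 : ℂ) • (1 : Matrix V V ℂ)) (lam • (1 : Matrix V V ℂ)) := by
  rw [mul_fromCols, fromCols_mul_fromBlocks]
  simp only [Matrix.add_mul, Matrix.smul_mul, Matrix.one_mul, J_St, J_Tt, Matrix.mul_smul,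
    Matrix.mul_one]
  rw [add_comm ((2 : ℂ) • (Smat G ℂ)ᵀ)]

lemma det_L (lam : ℂ) :
    (fromBlocks (lam • (1 : Matrix V V ℂ)) ((2 : ℂ) • (1 : Matrix V V ℂ))
        ((2 : ℂ) • (1 : Matrix V V ℂ)) (lam • (1 : Matrix V V ℂ))).det =
      (lam ^ 2 - 4) ^ Fintype.card V := by
  rw [det_blocks _ _ _ _ (by simp [smul_comm lam (2 : ℂ)])]
  have : (lam • (1 : Matrix V V ℂ)) * (lam • 1) - ((2 : ℂ) • 1) * ((2 : ℂ) • 1) =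
      (lam ^ 2 - 4) • 1 := by
    simp only [Matrix.smul_mul, Matrix.mul_smul, Matrix.one_mul]
    module
  rw [this, det_smul, det_one, mul_one]

lemma det_R (A : Matrix V V ℂ) (k lam : ℂ) :
    (fromBlocks (lam • (1 : Matrix V V ℂ)) ((2 : ℂ) • (1 : Matrix V V ℂ))
        ((2 : ℂ) • (1 : Matrix V V ℂ)) (lam • (1 : Matrix V V ℂ)) -
      fromBlocks (-A) (A ^ 2 - (k - 2) • (1 : Matrix V V ℂ)) ((2 : ℂ) • (1 : Matrix V V ℂ)) (-A) *
        fromBlocks (k • (1 : Matrix V V ℂ)) A A (k • (1 : Matrix V V ℂ))).det =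
      Matrix.det (lam ^ 2 • (1 : Matrix V V ℂ)
          - lam • (A ^ 3 - (3 * k - 4) • A)
          + (A ^ 4 - (k ^ 2) • A ^ 2 + (2 * (k - 1) * (k ^ 2 - 2 * k + 2)) • 1)) := by
  rw [fromBlocks_multiply, sub_eq_add_neg, fromBlocks_neg, fromBlocks_add, det_blocks]
  · congr 1
    simp only [Matrix.smul_mul, Matrix.mul_smul, Matrix.one_mul, Matrix.mul_one, Matrix.mul_sub,
      Matrix.sub_mul, Matrix.mul_add, Matrix.add_mul, Matrix.neg_mul, Matrix.mul_neg, neg_add, neg_neg, neg_sub, pow_succ,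
      pow_zero, Matrix.mul_assoc]
    module
  · simp only [Matrix.smul_mul, Matrix.mul_smul, Matrix.one_mul, Matrix.mul_one, Matrix.mul_sub,
      Matrix.sub_mul, Matrix.mul_add, Matrix.add_mul, Matrix.neg_mul, Matrix.mul_neg, neg_add, neg_neg, neg_sub, pow_succ,
      pow_zero, Matrix.mul_assoc]
    module

lemma card_le {k : ℕ} (hreg : G.IsRegularOfDegree k) (hk : 2 < k) :
    Fintype.card V ≤ G.edgeFinset.card := by
  have h := G.sum_degrees_eq_twice_card_edges
  simp only [hreg.degree_eq, Finset.sum_const, Finset.card_univ, smul_eq_mul] at h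
  nlinarith

end Aux

/-- Corollary 5.3: characteristic polynomial of `(U³)⁺` for a connected
`k`-regular graph with `k > 2` and girth `> 4`. -/
theorem charpoly_posSupp_grover_cube (G : SimpleGraph V) [DecidableRel G.Adj] (k : ℕ)
    (hconn : G.Connected) (hreg : G.IsRegularOfDegree k) (hk : 2 < k)
    (hg : 4 < G.egirth) (lam : ℂ) :
    Matrix.det (lam • (1 : Matrix G.Dart G.Dart ℂ) -
        (posSupp ((grover G) ^ 3)).map (fun x : ℝ => (x : ℂ))) =
      (lam ^ 2 - 4) ^ (G.edgeFinset.card - Fintype.card V) *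
        Matrix.det (lam ^ 2 • (1 : Matrix V V ℂ)
          - lam • ((G.adjMatrix ℂ) ^ 3 - (3 * (k : ℂ) - 4) • G.adjMatrix ℂ)
          + ((G.adjMatrix ℂ) ^ 4 - ((k : ℂ) ^ 2) • (G.adjMatrix ℂ) ^ 2
              + (2 * ((k : ℂ) - 1) * ((k : ℂ) ^ 2 - 2 * (k : ℂ) + 2)) •
                  (1 : Matrix V V ℂ))) := by
  have hd : Dense {x : ℂ | x ^ 2 - 4 ≠ 0} := by
    have : {x : ℂ | x ^ 2 - 4 ≠ 0} = ({2, -2} : Set ℂ)ᶜ := by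
      ext x
      have : x ^ 2 - 4 = (x - 2) * (x + 2) := by ring
      change x ^ 2 - 4 ≠ 0 ↔ ¬ (x = 2 ∨ x = -2)
      rw [this, ne_eq, mul_eq_zero, sub_eq_zero, add_eq_zero_iff_eq_neg]
    rw [this]
    exact Set.Countable.dense_compl ℂ (Set.toFinite _).countable
  refine congrFun (Continuous.ext_on hd (f := fun lam : ℂ => Matrix.det
    (lam • (1 : Matrix G.Dart G.Dart ℂ) -
        (posSupp ((grover G) ^ 3)).map (fun x : ℝ => (x : ℂ)))) (g := fun lam : ℂ =>
      (lam ^ 2 - 4) ^ (G.edgeFinset.card - Fintype.card V) *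
        Matrix.det (lam ^ 2 • (1 : Matrix V V ℂ)
          - lam • ((G.adjMatrix ℂ) ^ 3 - (3 * (k : ℂ) - 4) • G.adjMatrix ℂ)
          + ((G.adjMatrix ℂ) ^ 4 - ((k : ℂ) ^ 2) • (G.adjMatrix ℂ) ^ 2
              + (2 * ((k : ℂ) - 1) * ((k : ℂ) ^ 2 - 2 * (k : ℂ) + 2)) •
                  (1 : Matrix V V ℂ)))) (by fun_prop) (by fun_prop) ?_) lam
  intro x hx
  have hx' : x ^ 2 - 4 ≠ 0 := hx
  have hx2 : x ≠ 2 := by rintro rfl; norm_num at hx'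
  have e : x • (1 : Matrix G.Dart G.Dart ℂ) -
      (posSupp ((grover G) ^ 3)).map (fun x : ℝ => (x : ℂ)) =
      (x • (1 : Matrix G.Dart G.Dart ℂ) + (2 : ℂ) • Jmat G ℂ) -
      fromCols (Smat G ℂ)ᵀ (Tmat G ℂ)ᵀ *
      (fromBlocks (-G.adjMatrix ℂ) (G.adjMatrix ℂ ^ 2 - ((k : ℂ) - 2) • (1 : Matrix V V ℂ))
        ((2 : ℂ) • (1 : Matrix V V ℂ))
        (-G.adjMatrix ℂ) * fromRows (Smat G ℂ) (Tmat G ℂ)) := by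
    rw [map_posSupp hreg hk hg, W_eq]
    abel
  have key := det_transfer _ _ _ (fromBlocks (-G.adjMatrix ℂ)
    (G.adjMatrix ℂ ^ 2 - ((k : ℂ) - 2) • (1 : Matrix V V ℂ))
        ((2 : ℂ) • (1 : Matrix V V ℂ))
        (-G.adjMatrix ℂ) * fromRows (Smat G ℂ) (Tmat G ℂ)) (L_comm (G := G) x)
    (by rw [det_J G x hx2]; exact (pow_ne_zero _ hx').isUnit)
    (by rw [det_L]; exact (pow_ne_zero _ hx').isUnit)
  rw [Matrix.mul_assoc, fromRows_mul_fromCols, S_St ℂ hreg, T_Tt ℂ hreg, S_Tt, T_St, det_R,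
    det_L, det_J G x hx2, ← Nat.sub_add_cancel (card_le hreg hk), pow_add, mul_right_comm] at key
  have := mul_right_cancel₀ (pow_ne_zero _ hx') key
  simp only
  rw [e]
  exact this
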